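/- Let L be a positive definite Jacobi index of rank N, let s ∈ Mat_N(ℤ) with det s ≠ 0, and put L' = sᵀLs. Let μ ∈ ℤ^N, τ ∈ ℍ, z ∈ ℂ^N, and let M ⊂ ℤ^N be a (finite) set of representatives for the quotient group ℤ^N / sℤ^N. Then the families indexed below are summable and Σ_{r ∈ ℤ^N, r ≡ μ (mod Lℤ^N)} e(τ·rᵀL⁻¹r/2 + rᵀ(s·z)) = Σ_{μ' ∈ M} Σ_{r ∈ ℤ^N, r ≡ sᵀμ + sᵀLμ' (mod L'ℤ^N)} e(τ·rᵀ(L')⁻¹r/2 + rᵀz). -/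

import Mathlib

open Matrix Complex

noncomputable section

/-- `e(x) = exp(2πi·x)`. -/
def eC (x : ℂ) : ℂ := Complex.exp (2 * Real.pi * Complex.I * x)

/-- The casting `ℤ^N → ℂ^N`. -/
def zc {N : ℕ} (lam : Fin N → ℤ) : Fin N → ℂ := fun i => (lam i : ℂ)

theorem summable_prod_pi_int (f : ℤ → ℝ) (hf0 : 0 ≤ f) (hf : Summable f) (N : ℕ) :
    Summable (fun r : Fin N → ℤ => ∏ i, f (r i)) := by
  induction N with
  | zero => exact Summable.of_finite
  | succ N ih =>
    rw [← (Fin.consEquiv fun _ : Fin (N + 1) => ℤ).summable_iff]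
    refine (hf.mul_of_nonneg ih hf0 fun r => Finset.prod_nonneg fun i _ => hf0 _).congr fun x => ?_
    simp [Fin.consEquiv, Fin.prod_univ_succ]

theorem Matrix.PosDef.exists_mul_sum_sq_le {N : ℕ} {A : Matrix (Fin N) (Fin N) ℝ}
    (hA : A.PosDef) : ∃ T > 0, ∀ x : Fin N → ℝ, T * ∑ i, x i ^ 2 ≤ x ⬝ᵥ A *ᵥ x := by
  have hcont : Continuous fun x : Fin N → ℝ => x ⬝ᵥ A *ᵥ x := by fun_prop
  obtain ⟨δ, hδ, hle⟩ := (isCompact_sphere (0 : Fin N → ℝ) 1).exists_forall_le'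
    hcont.continuousOn (a := 0) fun x hx => by
      simpa using hA.dotProduct_mulVec_pos (x := x) (ne_zero_of_mem_unit_sphere ⟨x, hx⟩)
  refine ⟨δ / (N + 1), by positivity, fun x => ?_⟩
  have hnorm : δ * ‖x‖ ^ 2 ≤ x ⬝ᵥ A *ᵥ x := by
    rcases eq_or_ne x 0 with rfl | hx
    · simp
    have hx' : 0 < ‖x‖ := norm_pos_iff.mpr hx
    have h := hle (‖x‖⁻¹ • x) (by simp [norm_smul, hx'.ne'])
    rw [Matrix.mulVec_smul, smul_dotProduct, dotProduct_smul, smul_eq_mul, smul_eq_mul] at h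
    calc δ * ‖x‖ ^ 2 ≤ (‖x‖⁻¹ * (‖x‖⁻¹ * (x ⬝ᵥ A *ᵥ x))) * ‖x‖ ^ 2 := by gcongr
      _ = _ := by field_simp
  have hsum : ∑ i, x i ^ 2 ≤ (N + 1) * ‖x‖ ^ 2 :=
    calc ∑ i, x i ^ 2 ≤ ∑ _i : Fin N, ‖x‖ ^ 2 := Finset.sum_le_sum fun i _ => by
          rw [← sq_abs, ← Real.norm_eq_abs]
          gcongr
          exact norm_le_pi_norm x i
      _ = N * ‖x‖ ^ 2 := by simp
      _ ≤ _ := by gcongr; linarith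
  calc δ / (N + 1) * ∑ i, x i ^ 2 ≤ δ / (N + 1) * ((N + 1) * ‖x‖ ^ 2) := by gcongr
    _ = δ * ‖x‖ ^ 2 := by field_simp
    _ ≤ _ := hnorm

theorem norm_eC (w : ℂ) : ‖eC w‖ = Real.exp (-2 * Real.pi * w.im) := by
  rw [eC, Complex.norm_exp]
  simp

theorem summable_eC_of_posDef {N : ℕ} {A : Matrix (Fin N) (Fin N) ℝ} (hA : A.PosDef)
    (τ : UpperHalfPlane) (c : Fin N → ℂ) :
    Summable (fun r : Fin N → ℤ =>
      eC ((τ : ℂ) * (zc r ⬝ᵥ (A.map Complex.ofReal) *ᵥ zc r) / 2 + zc r ⬝ᵥ c)) := by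
  obtain ⟨T, hT, hle⟩ := hA.exists_mul_sum_sq_le
  have hτT : 0 < τ.im * T := mul_pos τ.im_pos hT
  have hbound : Summable fun n : ℤ =>
      Real.exp (-Real.pi * (τ.im * T * n ^ 2 - 2 * ‖c‖ * |(n : ℝ)|)) := by
    simpa using summable_pow_mul_jacobiTheta₂_term_bound ‖c‖ hτT 0
  refine Summable.of_norm_bounded
    (summable_prod_pi_int _ (fun n => (Real.exp_pos _).le) hbound N) fun r => ?_
  have hform : zc r ⬝ᵥ (A.map Complex.ofReal) *ᵥ zc r =
      (((fun i => (r i : ℝ)) ⬝ᵥ A *ᵥ fun i => (r i : ℝ) : ℝ) : ℂ) := by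
    simp [zc, dotProduct, Matrix.mulVec]
  have hlin : (zc r ⬝ᵥ c).im = ∑ i, (r i : ℝ) * (c i).im := by
    simp [zc, dotProduct]
  have habs : ∀ i, -(|(r i : ℝ)| * ‖c‖) ≤ (r i : ℝ) * (c i).im := fun i => by
    refine neg_le_of_abs_le ?_
    rw [abs_mul]
    gcongr
    exact (Complex.abs_im_le_norm _).trans (norm_le_pi_norm c i)
  have him : ((τ : ℂ) * (zc r ⬝ᵥ (A.map Complex.ofReal) *ᵥ zc r) / 2 + zc r ⬝ᵥ c).im =
      τ.im * ((fun i => (r i : ℝ)) ⬝ᵥ A *ᵥ fun i => (r i : ℝ)) / 2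
        + ∑ i, (r i : ℝ) * (c i).im := by
    rw [hform, Complex.add_im, hlin]
    simp
  rw [norm_eC, him, ← Real.exp_sum, Real.exp_le_exp, ← Finset.mul_sum,
    show ∀ y : ℝ, -2 * Real.pi * y = -Real.pi * (2 * y) by intro y; ring]
  refine mul_le_mul_of_nonpos_left ?_ (neg_nonpos.mpr Real.pi_pos.le)
  have h₁ := mul_le_mul_of_nonneg_left (hle fun i => (r i : ℝ)) τ.im_pos.le
  have h₂ := Finset.sum_le_sum fun i (_ : i ∈ Finset.univ) => habs i
  rw [Finset.sum_neg_distrib, ← Finset.sum_mul] at h₂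
  rw [Finset.sum_sub_distrib, ← Finset.mul_sum, ← Finset.mul_sum]
  linarith

theorem Matrix.inv_map_intCast_complex {N : ℕ} {L : Matrix (Fin N) (Fin N) ℤ}
    (hL : IsUnit (L.map (Int.cast : ℤ → ℝ))) :
    (L.map (Int.cast : ℤ → ℂ))⁻¹ = ((L.map (Int.cast : ℤ → ℝ))⁻¹).map Complex.ofReal := by
  refine Matrix.inv_eq_left_inv ?_
  have hmap : L.map (Int.cast : ℤ → ℂ) = (L.map (Int.cast : ℤ → ℝ)).map Complex.ofReal := by
    ext; simp
  have h := congrArg (fun B => B.map Complex.ofRealHom)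
    (Matrix.nonsing_inv_mul _ ((Matrix.isUnit_iff_isUnit_det _).mp hL))
  rw [Matrix.map_mul, Matrix.map_one _ (map_zero _) (map_one _)] at h
  rw [hmap]
  exact h

theorem summable_eC_of_posDef_int {N : ℕ} {L : Matrix (Fin N) (Fin N) ℤ}
    (hL : (L.map (Int.cast : ℤ → ℝ)).PosDef) (τ : UpperHalfPlane) (c : Fin N → ℂ) :
    Summable (fun r : Fin N → ℤ =>
      eC ((τ : ℂ) * (zc r ⬝ᵥ (L.map (Int.cast : ℤ → ℂ))⁻¹ *ᵥ zc r) / 2 + zc r ⬝ᵥ c)) := by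
  rw [Matrix.inv_map_intCast_complex hL.isUnit]
  exact summable_eC_of_posDef hL.inv τ c

theorem zc_mulVec {N : ℕ} (A : Matrix (Fin N) (Fin N) ℤ) (r : Fin N → ℤ) :
    zc (A *ᵥ r) = A.map (Int.cast : ℤ → ℂ) *ᵥ zc r := by
  ext i
  simp [zc, Matrix.mulVec, dotProduct]

theorem Matrix.isUnit_map_intCast {N : ℕ} {K : Type*} [Field K] [CharZero K]
    {s : Matrix (Fin N) (Fin N) ℤ} (hs : s.det ≠ 0) : IsUnit (s.map (Int.cast : ℤ → K)) := by
  rw [Matrix.isUnit_iff_isUnit_det, isUnit_iff_ne_zero]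
  have h : ((s.det : ℤ) : K) = (s.map (Int.cast : ℤ → K)).det := (Int.castRingHom K).map_det s
  rw [← h]
  exact_mod_cast hs

theorem Matrix.map_intCast_transpose_mul_mul {N : ℕ} {K : Type*} [CommRing K]
    (L s : Matrix (Fin N) (Fin N) ℤ) :
    (sᵀ * L * s).map (Int.cast : ℤ → K) =
      (s.map (Int.cast : ℤ → K))ᵀ * L.map (Int.cast : ℤ → K) * s.map (Int.cast : ℤ → K) := by
  ext
  simp [Matrix.mul_apply]

theorem Matrix.PosDef.map_transpose_mul_mul {N : ℕ} {L s : Matrix (Fin N) (Fin N) ℤ}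
    (hL : (L.map (Int.cast : ℤ → ℝ)).PosDef) (hs : s.det ≠ 0) :
    ((sᵀ * L * s).map (Int.cast : ℤ → ℝ)).PosDef := by
  have h := hL.conjTranspose_mul_mul_same
    (Matrix.mulVec_injective_of_isUnit (Matrix.isUnit_map_intCast (K := ℝ) hs))
  rwa [Matrix.conjTranspose_eq_transpose_of_trivial,
    ← Matrix.map_intCast_transpose_mul_mul] at h

theorem dotProduct_inv_transpose_mul_mul {N : ℕ} (L s : Matrix (Fin N) (Fin N) ℤ)
    (hs : s.det ≠ 0) (r : Fin N → ℤ) :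
    zc (sᵀ *ᵥ r) ⬝ᵥ ((sᵀ * L * s).map (Int.cast : ℤ → ℂ))⁻¹ *ᵥ zc (sᵀ *ᵥ r) =
      zc r ⬝ᵥ (L.map (Int.cast : ℤ → ℂ))⁻¹ *ᵥ zc r := by
  have hdet := (Matrix.isUnit_iff_isUnit_det _).mp (Matrix.isUnit_map_intCast (K := ℂ) hs)
  rw [zc_mulVec, Matrix.map_intCast_transpose_mul_mul, Matrix.transpose_map, Matrix.mul_inv_rev, Matrix.mul_inv_rev]
  generalize s.map (Int.cast : ℤ → ℂ) = S at *
  generalize L.map (Int.cast : ℤ → ℂ) = A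
  have hdetT : IsUnit Sᵀ.det := by rwa [Matrix.det_transpose]
  rw [Matrix.mulVec_mulVec, Matrix.mul_assoc, Matrix.mul_assoc, Matrix.nonsing_inv_mul _ hdetT,
    Matrix.mul_one, Matrix.mulVec_transpose, ← Matrix.dotProduct_mulVec, Matrix.mulVec_mulVec,
    Matrix.mul_nonsing_inv_cancel_left _ _ hdet]

theorem image_transpose_mulVec_coset {N : ℕ} (L s : Matrix (Fin N) (Fin N) ℤ)
    (μ : Fin N → ℤ) (M : Finset (Fin N → ℤ))
    (hM : ∀ x : Fin N → ℤ, ∃ μ' ∈ M, ∃ lam : Fin N → ℤ, x = μ' + s *ᵥ lam) :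
    (sᵀ *ᵥ ·) '' {r | ∃ lam, r = μ + L *ᵥ lam} =
      ⋃ μ' ∈ M, {r | ∃ lam, r = sᵀ *ᵥ μ + (sᵀ * L) *ᵥ μ' + (sᵀ * L * s) *ᵥ lam} := by
  ext r
  simp only [Set.mem_image, Set.mem_ofPred_eq, Set.mem_iUnion, exists_prop]
  constructor
  · rintro ⟨_, ⟨lam, rfl⟩, rfl⟩
    obtain ⟨μ', hμ', ν, rfl⟩ := hM lam
    exact ⟨μ', hμ', ν, by simp [Matrix.mulVec_add, Matrix.mul_assoc, add_assoc]⟩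
  · rintro ⟨μ', -, ν, rfl⟩
    exact ⟨_, ⟨μ' + s *ᵥ ν, rfl⟩, by simp [Matrix.mulVec_add, Matrix.mul_assoc, add_assoc]⟩

/-- Theta decomposition identity for the pullback along
`s ∈ Mat_N(ℤ)`, `det s ≠ 0`: with `L' = sᵀLs` and `M` a set of representatives of
`ℤ^N / sℤ^N`,
`Σ_{r ≡ μ (L)} e(τ·rᵀL⁻¹r/2 + rᵀ(sz)) = Σ_{μ' ∈ M} Σ_{r ≡ sᵀμ + sᵀLμ' (L')} e(τ·rᵀL'⁻¹r/2 + rᵀz)`,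
all the families being summable. -/
theorem theta_pullback_identity
    (N : ℕ) (L : Matrix (Fin N) (Fin N) ℤ)
    (hSym : L.IsSymm) (hEven : ∀ i, Even (L i i))
    (hPos : (L.map (Int.cast : ℤ → ℝ)).PosDef)
    (s : Matrix (Fin N) (Fin N) ℤ) (hs : s.det ≠ 0)
    (μ : Fin N → ℤ) (τ : UpperHalfPlane) (z : Fin N → ℂ)
    (M : Finset (Fin N → ℤ))
    (hM : ∀ x : Fin N → ℤ, ∃! μ' : Fin N → ℤ,
      μ' ∈ M ∧ ∃ lam : Fin N → ℤ, x = μ' + s.mulVec lam) :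
    Summable (fun r : {r : Fin N → ℤ // ∃ lam : Fin N → ℤ, r = μ + L.mulVec lam} =>
      eC ((τ : ℂ) * (zc r.1 ⬝ᵥ ((L.map (Int.cast : ℤ → ℂ))⁻¹).mulVec (zc r.1)) / 2
        + zc r.1 ⬝ᵥ (s.map (Int.cast : ℤ → ℂ)).mulVec z)) ∧
    (∀ μ' ∈ M,
      Summable (fun r : {r : Fin N → ℤ //
          ∃ lam : Fin N → ℤ, r = sᵀ.mulVec μ + (sᵀ * L).mulVec μ' + (sᵀ * L * s).mulVec lam} =>
        eC ((τ : ℂ) * (zc r.1 ⬝ᵥ (((sᵀ * L * s).map (Int.cast : ℤ → ℂ))⁻¹).mulVec (zc r.1)) / 2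
          + zc r.1 ⬝ᵥ z))) ∧
    (∑' r : {r : Fin N → ℤ // ∃ lam : Fin N → ℤ, r = μ + L.mulVec lam},
      eC ((τ : ℂ) * (zc r.1 ⬝ᵥ ((L.map (Int.cast : ℤ → ℂ))⁻¹).mulVec (zc r.1)) / 2
        + zc r.1 ⬝ᵥ (s.map (Int.cast : ℤ → ℂ)).mulVec z))
    = ∑ μ' ∈ M,
      ∑' r : {r : Fin N → ℤ //
          ∃ lam : Fin N → ℤ, r = sᵀ.mulVec μ + (sᵀ * L).mulVec μ' + (sᵀ * L * s).mulVec lam},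
        eC ((τ : ℂ) * (zc r.1 ⬝ᵥ (((sᵀ * L * s).map (Int.cast : ℤ → ℂ))⁻¹).mulVec (zc r.1)) / 2
          + zc r.1 ⬝ᵥ z) := by
  have hG := summable_eC_of_posDef_int (hPos.map_transpose_mul_mul hs) τ z
  have hinj : Function.Injective (sᵀ *ᵥ ·) :=
    Matrix.mulVec_injective_of_det_ne_zero (by rwa [Matrix.det_transpose])
  have hLs : Function.Injective ((sᵀ * L) *ᵥ ·) := by
    refine Matrix.mulVec_injective_of_det_ne_zero ?_
    rw [Matrix.det_mul, Matrix.det_transpose]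
    refine mul_ne_zero hs fun h => hPos.det_pos.ne' ?_
    have hdet : ((L.det : ℤ) : ℝ) = (L.map (Int.cast : ℤ → ℝ)).det :=
      (Int.castRingHom ℝ).map_det L
    rw [← hdet, h, Int.cast_zero]
  refine ⟨(summable_eC_of_posDef_int hPos τ _).subtype _, fun μ' _ => hG.subtype _, ?_⟩
  refine Eq.trans ?_ (Summable.tsum_finset_bUnion_disjoint (t := fun μ' : Fin N → ℤ =>
      {r | ∃ lam, r = sᵀ *ᵥ μ + (sᵀ * L) *ᵥ μ' + (sᵀ * L * s) *ᵥ lam}) ?_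
      fun μ' _ => hG.subtype _)
  · rw [← image_transpose_mulVec_coset L s μ M fun x => (hM x).exists.imp fun _ h => h,
      tsum_image (fun r => eC ((τ : ℂ) *
        (zc r ⬝ᵥ ((sᵀ * L * s).map (Int.cast : ℤ → ℂ))⁻¹ *ᵥ zc r) / 2 + zc r ⬝ᵥ z)) hinj.injOn]
    refine tsum_congr fun r => ?_
    rw [dotProduct_inv_transpose_mul_mul L s hs, zc_mulVec, Matrix.transpose_map,
      Matrix.mulVec_transpose, ← Matrix.dotProduct_mulVec]
  · intro μ₁ h₁ μ₂ h₂ hne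
    refine Set.disjoint_left.mpr ?_
    rintro _ ⟨ν₁, rfl⟩ ⟨ν₂, h⟩
    rw [add_assoc, add_assoc, add_right_inj, ← Matrix.mulVec_mulVec _ (sᵀ * L) s,
      ← Matrix.mulVec_mulVec _ (sᵀ * L) s, ← Matrix.mulVec_add, ← Matrix.mulVec_add] at h
    exact hne ((hM _).unique ⟨h₁, ν₁, rfl⟩ ⟨h₂, ν₂, hLs h⟩)
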